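/- Let n and α be powers of two with 1 ≤ α ≤ log₂ n, and consider the tree ensemble of order α whose composite tree and elementary trees all have height H = log₂(n/α) and whose common root label is [0,1). If at most n elements of [0,1) are inserted one by one via the ensemble insertion algorithm, then no insertion ever fails: every element is successfully placed. -/

import Mathlib

noncomputable section
attribute [local instance] Classical.propDecidable

/-- The state of an elementary tree: nodes are identified with paths from the root
(`false` = left, `true` = right); `label` records the interval `[lo, hi)` labeling a
marked node (`none` = unmarked), and `occ` records the element written in a leaf cell. -/
structure ETState where
  label : List Bool → Option (ℝ × ℝ)
  occ : List Bool → Option ℝ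

/-- The initial state of an elementary tree whose root is statically labeled `I`. -/
def ETState.init (I : ℝ × ℝ) : ETState :=
  ⟨fun p => if p = [] then some I else none, fun _ => none⟩

/-- The half of the interval `I = [lo, hi)` containing `x`. -/
def halfContaining (I : ℝ × ℝ) (x : ℝ) : ℝ × ℝ :=
  if x < (I.1 + I.2) / 2 then (I.1, (I.1 + I.2) / 2) else ((I.1 + I.2) / 2, I.2)

def ETState.setLabel (s : ETState) (p : List Bool) (I : ℝ × ℝ) : ETState :=
  ⟨fun q => if q = p then some I else s.label q, s.occ⟩

def ETState.setOcc (s : ETState) (p : List Bool) (x : ℝ) : ETState :=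
  ⟨s.label, fun q => if q = p then some x else s.occ q⟩

/-- `etInsert d p pl x s` is the recursive procedure `insert(v, x)` at the node `v` with
path `p` and height `d` above the leaves (so leaves have `d = 0`), where `pl` is the label
of `v`'s parent.  It returns the success flag together with the updated state:
* an unmarked leaf gets labeled with the half of `pl` containing `x`, and `x` is written
  into its cell (success); a marked leaf yields failure;
* a marked internal node: failure if `x` is inadmissible, otherwise insert into the left
  child and, if that fails, into the right child;
* an unmarked internal node gets labeled with the half of `pl` containing `x`, and the
  insertion proceeds into its left child. -/
def etInsert : ℕ → List Bool → (ℝ × ℝ) → ℝ → ETState → Bool × ETState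
  | 0, p, pl, x, s =>
    match s.label p with
    | none => (true, (s.setLabel p (halfContaining pl x)).setOcc p x)
    | some _ => (false, s)
  | d + 1, p, pl, x, s =>
    match s.label p with
    | none =>
        let I := halfContaining pl x
        etInsert d (p ++ [false]) I x (s.setLabel p I)
    | some I =>
        if I.1 ≤ x ∧ x < I.2 then
          match etInsert d (p ++ [false]) I x s with
          | (true, s') => (true, s')
          | (false, s') => etInsert d (p ++ [true]) I x s'
        else (false, s)

/-- Insert `x` at the root of an elementary tree of height `h` (the root is always
marked, so the parent label passed along is irrelevant). -/
def etInsertTop (h : ℕ) (x : ℝ) (s : ETState) : Bool × ETState :=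
  etInsert h [] ((s.label []).getD (0, 1)) x s

/-- Insert the elements of `xs` one by one into an elementary tree of height `h` with
root label `I`, returning the conjunction of all success flags and the final state. -/
def etRunAll (h : ℕ) (I : ℝ × ℝ) (xs : List ℝ) : Bool × ETState :=
  xs.foldl (fun acc x =>
    let r := etInsertTop h x acc.2
    (acc.1 && r.1, r.2)) (true, ETState.init I)

/-- The path (of length `h`) of the `i`-th leaf from the left in a tree of height `h`. -/
def pathOfIdx (h i : ℕ) : List Bool :=
  (List.range h).map fun k => Nat.testBit i (h - 1 - k)

/-- The static label of the composite-tree node at path `p` when the root is labeled `I`: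
each step descends to the left or right half of the parent's interval. -/
def staticLabel : (ℝ × ℝ) → List Bool → ℝ × ℝ
  | I, [] => I
  | I, b :: p =>
      staticLabel (if b then ((I.1 + I.2) / 2, I.2) else (I.1, (I.1 + I.2) / 2)) p

/-- The state of a composite tree: each node (a path of length `≤ H - 1` from the root)
carries an elementary tree. -/
def CTState : Type := List Bool → ETState

/-- The initial state of a composite tree with root label `I`: every node carries an empty
elementary tree whose root is statically labeled with the node's static label. -/
def ctInit (I : ℝ × ℝ) : CTState := fun p => ETState.init (staticLabel I p)

/-- The path of length `d` descending from an interval `I` always into the half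
containing `x`; this is the path to the unique depth-`d` node whose static label
contains `x`. -/
def descend (x : ℝ) : (ℝ × ℝ) → ℕ → List Bool
  | _, 0 => []
  | I, d + 1 =>
      if x < (I.1 + I.2) / 2 then false :: descend x (I.1, (I.1 + I.2) / 2) d
      else true :: descend x ((I.1 + I.2) / 2, I.2) d

/-- The sequence of composite-tree nodes tried when inserting `x` into a composite tree of
height `H` with root label `I`: the unique admissible leaf (height 1), then its parent
(height 2), and so on up to the root (height `H`); each entry is the node's path paired
with the height of its elementary tree. -/
def ctNodeSeq (H : ℕ) (I : ℝ × ℝ) (x : ℝ) : List (List Bool × ℕ) :=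
  (List.range H).map fun i => ((descend x I (H - 1)).take (H - 1 - i), i + 1)

/-- Try to insert `x` into the elementary trees at the listed composite-tree nodes, in
order, stopping at the first success. -/
def tryNodes (x : ℝ) : List (List Bool × ℕ) → CTState → Bool × CTState
  | [], f => (false, f)
  | (p, ht) :: rest, f =>
      match etInsertTop ht x (f p) with
      | (true, s') => (true, fun q => if q = p then s' else f q)
      | (false, s') => tryNodes x rest fun q => if q = p then s' else f q

/-- Insert `x` into a composite tree of height `H` with root label `I`: walk from the
unique admissible leaf up towards the root, inserting into the first elementary tree on
this path that accepts `x`. -/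
def ctInsert (H : ℕ) (I : ℝ × ℝ) (x : ℝ) (f : CTState) : Bool × CTState :=
  tryNodes x (ctNodeSeq H I x) f

/-- The state of a tree ensemble: one composite tree `A` followed by elementary trees
`B 0, B 1, …` (of which only the first `α` are used in an ensemble of order `α`). -/
structure EnsState where
  A : CTState
  B : ℕ → ETState

/-- The initial state of a tree ensemble with common root label `I`. -/
def ensInit (I : ℝ × ℝ) : EnsState := ⟨ctInit I, fun _ => ETState.init I⟩

/-- Try to insert `x` into the elementary trees `B j` for the listed indices `j`, in
order, stopping at the first success. -/
def tryBs (H : ℕ) (x : ℝ) : List ℕ → (ℕ → ETState) → Bool × (ℕ → ETState)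
  | [], B => (false, B)
  | j :: rest, B =>
      match etInsertTop H x (B j) with
      | (true, s') => (true, fun i => if i = j then s' else B i)
      | (false, s') => tryBs H x rest fun i => if i = j then s' else B i

/-- Insert `x` into a tree ensemble of order `α` (trees of height `H`, common root label
`I`): first try the composite tree `A`; if that fails, try `B 0, …, B (α-1)` in order. -/
def ensInsert (H α : ℕ) (I : ℝ × ℝ) (x : ℝ) (s : EnsState) : Bool × EnsState :=
  match ctInsert H I x s.A with
  | (true, A') => (true, ⟨A', s.B⟩)
  | (false, A') =>
      let r := tryBs H x (List.range α) s.B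
      (r.1, ⟨A', r.2⟩)

/-- Insert the elements of `xs` one by one into a tree ensemble of order `α` with trees of
height `H` and common root label `I`, returning the conjunction of all success flags
together with the final state. -/
def ensRun (H α : ℕ) (I : ℝ × ℝ) (xs : List ℝ) : Bool × EnsState :=
  xs.foldl (fun acc x =>
    let r := ensInsert H α I x acc.2
    (acc.1 && r.1, r.2)) (true, ensInit I)

/-! ### Dyadic intervals -/
def MemI (x : ℝ) (I : ℝ × ℝ) : Prop := I.1 ≤ x ∧ x < I.2
def SubI (J I : ℝ × ℝ) : Prop := ∀ y, MemI y J → MemI y I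
def dy (q : List Bool) : ℝ × ℝ := staticLabel (0, 1) q
def ds (x : ℝ) (m : ℕ) : List Bool := descend x (0, 1) m

lemma descend_length (x : ℝ) (m : ℕ) : ∀ I, (descend x I m).length = m := by
  induction m with
  | zero => intro I; simp [descend]
  | succ m ih => intro I; simp only [descend]; split_ifs <;> simp [ih]

lemma staticLabel_lt (q : List Bool) : ∀ I : ℝ × ℝ, I.1 < I.2 →
    (staticLabel I q).1 < (staticLabel I q).2 := by
  induction q with
  | nil => intro I h; simpa [staticLabel] using h
  | cons b q ih =>
    intro I h
    simp only [staticLabel]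
    apply ih
    split_ifs <;> simp <;> linarith

lemma staticLabel_sub (q : List Bool) : ∀ I : ℝ × ℝ, I.1 < I.2 → SubI (staticLabel I q) I := by
  induction q with
  | nil => intro I h y hy; simpa [staticLabel] using hy
  | cons b q ih =>
    intro I h y hy
    simp only [staticLabel] at hy
    have := ih _ (by split_ifs <;> simp <;> linarith) y hy
    unfold MemI at *
    split_ifs at this <;> simp at this <;> constructor <;> linarith

lemma staticLabel_append (q r : List Bool) : ∀ I : ℝ × ℝ,
    staticLabel I (q ++ r) = staticLabel (staticLabel I q) r := by
  induction q with
  | nil => intro I; simp [staticLabel]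
  | cons b q ih => intro I; simp [staticLabel, ih]

lemma descend_mem (x : ℝ) (m : ℕ) : ∀ I, MemI x I → MemI x (staticLabel I (descend x I m)) := by
  induction m with
  | zero => intro I h; simpa [descend, staticLabel] using h
  | succ m ih =>
    intro I h
    simp only [descend]
    split_ifs with hx
    · simp only [staticLabel]; apply ih; unfold MemI at *; simp; exact ⟨h.1, hx⟩
    · simp only [staticLabel]; apply ih; unfold MemI at *; simp; exact ⟨not_lt.1 hx, h.2⟩

lemma descend_uniq (x : ℝ) (q : List Bool) : ∀ I : ℝ × ℝ, I.1 < I.2 → MemI x (staticLabel I q) →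
    q = descend x I q.length := by
  induction q with
  | nil => intro I _ _; simp [descend]
  | cons b q ih =>
    intro I h hx
    simp only [staticLabel] at hx
    have hlt : (if b then ((I.1 + I.2) / 2, I.2) else (I.1, (I.1 + I.2) / 2) : ℝ × ℝ).1 <
      (if b then ((I.1 + I.2) / 2, I.2) else (I.1, (I.1 + I.2) / 2) : ℝ × ℝ).2 := by
      split_ifs <;> simp <;> linarith
    have h2 := staticLabel_sub _ _ hlt x hx
    have h3 := ih _ hlt hx
    cases b
    · simp [MemI] at h2
      simp only [List.length_cons, descend, if_pos h2.2]
      simpa using h3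
    · simp [MemI] at h2
      simp only [List.length_cons, descend, if_neg (not_lt.2 h2.1)]
      simpa using h3

lemma descend_half (x : ℝ) (m : ℕ) : ∀ I, staticLabel I (descend x I (m+1)) =
    halfContaining (staticLabel I (descend x I m)) x := by
  induction m with
  | zero => 
    intro I
    by_cases hx : x < (I.1 + I.2) / 2
    · simp [descend, halfContaining, staticLabel, hx]
    · simp [descend, halfContaining, staticLabel, hx]
  | succ m ih =>
    intro I
    rw [descend]
    conv_rhs => rw [descend]
    split_ifs with h
    · simpa [staticLabel] using ih _
    · simpa [staticLabel] using ih _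

lemma descend_take (x : ℝ) (m : ℕ) : ∀ I n, n ≤ m → (descend x I m).take n = descend x I n := by
  induction m with
  | zero => intro I n h; obtain rfl : n = 0 := by omega
            simp [descend]
  | succ m ih =>
    intro I n h
    cases n with
    | zero => simp [descend]
    | succ n =>
      simp only [descend]
      split_ifs <;> simp [ih _ n (by omega)]

lemma dy_lt (q : List Bool) : (dy q).1 < (dy q).2 := staticLabel_lt q _ (by norm_num)
lemma ds_length (x : ℝ) (m : ℕ) : (ds x m).length = m := descend_length x m _
lemma ds_mem {x : ℝ} (hx : MemI x (0,1)) (m : ℕ) : MemI x (dy (ds x m)) := descend_mem x m _ hx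
lemma ds_uniq {x : ℝ} {q : List Bool} (h : MemI x (dy q)) : q = ds x q.length :=
  descend_uniq x q _ (by norm_num) h
lemma ds_half (x : ℝ) (m : ℕ) : dy (ds x (m+1)) = halfContaining (dy (ds x m)) x :=
  descend_half x m _
lemma dy_sub_append (q r : List Bool) : SubI (dy (q ++ r)) (dy q) := by
  unfold dy; rw [staticLabel_append]; exact staticLabel_sub _ _ (dy_lt q)
lemma dy_inj {q r : List Bool} (hl : q.length = r.length) (h : dy q = dy r) : q = r := by
  have h1 : MemI (dy q).1 (dy q) := ⟨le_refl _, dy_lt q⟩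
  have h2 := h ▸ h1
  rw [ds_uniq h1, hl]
  exact (ds_uniq (by simpa [h] using h2)).symm
lemma ds_take {x : ℝ} {m n : ℕ} (h : n ≤ m) : (ds x m).take n = ds x n := descend_take x m _ n h
lemma ds_sub (x : ℝ) {m n : ℕ} (h : n ≤ m) : SubI (dy (ds x m)) (dy (ds x n)) := by
  have := dy_sub_append ((ds x m).take n) ((ds x m).drop n)
  rwa [List.take_append_drop, ds_take h] at this

/-! ### Left-of relation -/
def Lf : List Bool → List Bool → Prop
  | a :: u, b :: w => (a = false ∧ b = true) ∨ (a = b ∧ Lf u w)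
  | _, _ => False

@[simp] lemma Lf_nil_left (w : List Bool) : ¬ Lf [] w := by simp [Lf]
@[simp] lemma Lf_nil_right (w : List Bool) : ¬ Lf w [] := by cases w <;> simp [Lf]
@[simp] lemma Lf_cons (a b : Bool) (u w : List Bool) :
    Lf (a :: u) (b :: w) ↔ (a = false ∧ b = true) ∨ (a = b ∧ Lf u w) := by simp [Lf]
@[simp] lemma Lf_append (v u w : List Bool) : Lf (v ++ u) (v ++ w) ↔ Lf u w := by
  induction v with
  | nil => simp
  | cons a v ih => cases a <;> simp [ih]

lemma Lf_tri (u : List Bool) : ∀ w, u.length = w.length → u ≠ w → Lf u w ∨ Lf w u := by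
  induction u with
  | nil => intro w h hne; cases w <;> simp_all
  | cons a u ih =>
    intro w h hne
    cases w with
    | nil => simp at h
    | cons b w =>
      have := ih w (by simpa using h)
      cases a <;> cases b <;> simp_all

lemma Lf_true_mem (u : List Bool) : ∀ w, Lf u w → true ∈ w := by
  induction u with
  | nil => intro w h; simp at h
  | cons a u ih =>
    intro w h
    cases w with
    | nil => simp at h
    | cons b w =>
      rw [Lf_cons] at h
      rcases h with h | h
      · simp [h.2]
      · simp [ih w h.2]

lemma Lf_replicate (u : List Bool) (i : ℕ) : ¬ Lf u (List.replicate i false) := by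
  intro h; have := Lf_true_mem _ _ h; simp at this

lemma Lf_right (c r : List Bool) : ∀ u, Lf u (c ++ r) → Lf u c ∨ ∃ z, u = c ++ z ∧ Lf z r := by
  induction c with
  | nil => intro u h; right; exact ⟨u, by simp, by simpa using h⟩
  | cons b c ih =>
    intro u h
    cases u with
    | nil => simp at h
    | cons a u =>
      rw [List.cons_append, Lf_cons] at h
      rcases h with h | h
      · left; simp [h]
      · rcases ih u h.2 with h' | ⟨z, hz, hz'⟩
        · left; simp [h, h']
        · right; exact ⟨z, by simp [h, hz], hz'⟩

lemma Lf_left (p : List Bool) (b : Bool) (r : List Bool) : ∀ u, Lf (p ++ b :: r) u →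
    Lf p u ∨ (b = false ∧ ∃ z, u = p ++ true :: z) ∨ ∃ z, u = p ++ b :: z := by
  induction p with
  | nil =>
    intro u h
    cases u with
    | nil => simp at h
    | cons a u => cases a <;> cases b <;> simp_all
  | cons a p ih =>
    intro u h
    cases u with
    | nil => simp at h
    | cons a' u =>
      rw [List.cons_append, Lf_cons] at h
      rcases h with h | h
      · left; simp [h]
      · rcases ih u h.2 with h' | ⟨hb, z, hz⟩ | ⟨z, hz⟩
        · left; simp [h, h']
        · right; left; exact ⟨hb, z, by simp [h, hz]⟩
        · right; right; exact ⟨z, by simp [h, hz]⟩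

/-! ### A single elementary tree -/
structure TG (h : ℕ) (base : List Bool) (s : ETState) : Prop where
  root : s.label [] = some (dy base)
  lab : ∀ u I, s.label u = some I → u.length ≤ h ∧ ∃ q, q.length = u.length ∧ I = dy (base ++ q)
  par : ∀ u b J, s.label (u ++ [b]) = some J → ∃ I, s.label u = some I ∧ SubI J I
  left : ∀ u, s.label (u ++ [true]) ≠ none → s.label (u ++ [false]) ≠ none

lemma TG.pre {h base s} (H : TG h base s) (u w : List Bool) : ∀ J, s.label (u ++ w) = some J →
    ∃ I, s.label u = some I ∧ SubI J I := by
  induction w using List.reverseRecOn with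
  | nil => intro J hJ; exact ⟨J, by simpa using hJ, fun y hy => hy⟩
  | append_singleton w b ih =>
    intro J hJ
    rw [← List.append_assoc] at hJ
    obtain ⟨I, hI, hs⟩ := H.par _ _ _ hJ
    obtain ⟨I', hI', hs'⟩ := ih I hI
    exact ⟨I', hI', fun y hy => hs' y (hs y hy)⟩

lemma TG.pre_none {h base s} (H : TG h base s) {u : List Bool} (hu : s.label u = none)
    (w : List Bool) : s.label (u ++ w) = none := by
  by_contra hc
  obtain ⟨J, hJ⟩ := Option.ne_none_iff_exists'.1 hc
  obtain ⟨I, hI, _⟩ := H.pre u w J hJ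
  simp [hu] at hI

lemma TG.lab_ds {h base s} (H : TG h base s) {u : List Bool} {I x} (hu : s.label u = some I)
    (hx : MemI x I) : I = dy (ds x (base.length + u.length)) := by
  obtain ⟨_, q, hq, rfl⟩ := H.lab u I hu
  have := ds_uniq hx
  rw [List.length_append, hq] at this
  rw [← this]

/-- `s'` is obtained from `s` by marking the leftmost chain below `c` down to depth `d`. -/
structure Chain (c : List Bool) (d m : ℕ) (x : ℝ) (s s' : ETState) : Prop where
  new : ∀ i ≤ d, s'.label (c ++ List.replicate i false) = some (dy (ds x (m + i)))
  old : ∀ u, (¬ ∃ i ≤ d, u = c ++ List.replicate i false) → s'.label u = s.label u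

lemma insert_chain (x : ℝ) (d : ℕ) : ∀ (v : List Bool) (m : ℕ) (s : ETState),
    (∀ w, s.label (v ++ w) = none) →
    ∃ s', etInsert d v (dy (ds x m)) x s = (true, s') ∧ Chain v d (m+1) x s s' := by
  induction d with
  | zero =>
    intro v m s hv
    have h0 : s.label v = none := by simpa using hv []
    refine ⟨_, by simp [etInsert, h0]; rfl, ?_, ?_⟩
    · intro i hi
      obtain rfl : i = 0 := by omega
      simp [ETState.setOcc, ETState.setLabel, ds_half]
    · intro u hu
      have : u ≠ v := fun h => hu ⟨0, le_refl _, by simp [h]⟩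
      simp [ETState.setOcc, ETState.setLabel, this]
  | succ d ih =>
    intro v m s hv
    have h0 : s.label v = none := by simpa using hv []
    obtain ⟨s', h1, h2⟩ := ih (v ++ [false]) (m+1) (s.setLabel v (dy (ds x (m+1)))) (by
      intro w
      have : v ++ false :: w ≠ v := by simp
      simp [ETState.setLabel, this]
      exact hv _)
    refine ⟨s', ?_, ?_, ?_⟩
    · simp only [etInsert, h0]
      rw [← ds_half]; exact h1
    · intro i hi
      cases i with
      | zero =>
        rw [h2.old]
        · simp [ETState.setLabel]
        · rintro ⟨i, _, hi'⟩
          simp at hi'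
      | succ i =>
        have := h2.new i (by omega)
        rw [List.append_assoc] at this
        rw [show m + 1 + (i + 1) = m + 1 + 1 + i by omega]
        simpa only [List.replicate_succ, List.singleton_append] using this
    · intro u hu
      rw [h2.old]
      · have : u ≠ v := fun h => hu ⟨0, by omega, by simp [h]⟩
        simp [ETState.setLabel, this]
      · rintro ⟨i, hi, rfl⟩
        exact hu ⟨i+1, by omega, by simp [List.replicate_succ]⟩

def Full (s : ETState) (u : List Bool) : Prop := ∀ b, s.label (u ++ [b]) ≠ none

/-- all the marked internal nodes `v ++ w` with `R w` that admit `x` are full. -/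
def AllFull (s : ETState) (x : ℝ) (v : List Bool) (d : ℕ) (R : List Bool → Prop) : Prop :=
  ∀ w J, R w → s.label (v ++ w) = some J → w.length < d → MemI x J → Full s (v ++ w)

lemma insert_marked {h base s} (H : TG h base s) (x : ℝ) (d : ℕ) : ∀ (v : List Bool) (pl I : ℝ × ℝ),
    v.length + d = h → s.label v = some I →
    (etInsert d v pl x s = (false, s) ∧ (MemI x I → AllFull s x v d (fun _ => True))) ∨
    (∃ s' p b Ip, etInsert d v pl x s = (true, s') ∧ p.length < d ∧ s.label (v ++ p) = some Ip ∧
      MemI x Ip ∧ s.label (v ++ p ++ [b]) = none ∧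
      (b = true → s.label (v ++ p ++ [false]) ≠ none) ∧
      Chain (v ++ p ++ [b]) (d - 1 - p.length) (base.length + v.length + p.length + 1) x s s' ∧
      AllFull s x v d (fun w => Lf w (p ++ [b]))) := by
  induction d with
  | zero =>
    intro v pl I hd hv
    left
    refine ⟨by simp [etInsert, hv], fun _ w J _ _ hw => by omega⟩
  | succ d ih =>
    intro v pl I hd hv
    by_cases hx : MemI x I
    swap
    · left
      refine ⟨?_, fun h => absurd h hx⟩
      simp only [etInsert, hv]
      exact if_neg hx
    have hI := H.lab_ds hv hx
    have key : ∀ r, etInsert d (v ++ [false]) I x s = r → etInsert (d+1) v pl x s =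
        match r with
          | (true, s') => (true, s')
          | (false, s') => etInsert d (v ++ [true]) I x s' := by
      rintro r rfl
      simp only [etInsert, hv]
      exact if_pos hx
    cases hL : s.label (v ++ [false]) with
    | none =>
      right
      obtain ⟨s', h1, h2⟩ := insert_chain x d (v ++ [false]) (base.length + v.length) s
        (H.pre_none hL)
      rw [← hI] at h1
      refine ⟨s', [], false, I, key _ h1, by simp, by simpa using hv, hx, by simpa using hL,
        by simp, by simpa using h2, ?_⟩
      intro w J hw
      exfalso
      cases w with
      | nil => simp at hw
      | cons a w => simp at hw
    | some IL =>
      have hdl : (v ++ [false]).length + d = h := by simp; omega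
      have hdr : (v ++ [true]).length + d = h := by simp; omega
      rcases ih (v ++ [false]) I IL hdl hL with ⟨hf, haf⟩ | ⟨s', p, b, Ip, h1, h2, h3, h4, h5, h6, h7, h8⟩
      swap
      · right
        refine ⟨s', false :: p, b, Ip, key _ h1, by simp; omega, by simpa using h3, h4,
          by simpa using h5, by simpa using h6, ?_, ?_⟩
        · convert h7 using 1
          · simp
          · simp; omega
          · simp; omega
        · intro w J hw hl hlen hm
          rcases w with _ | ⟨_ | _, w⟩
          · simp at hw
          · have := h8 w J (by simpa using hw) (by simpa using hl) (by simpa using hlen) hm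
            simpa using this
          · simp at hw
      have hleft : ∀ w J, s.label (v ++ false :: w) = some J → w.length < d → MemI x J →
          Full s (v ++ false :: w) := by
        intro w J hl hlen hm
        have hl' : s.label ((v ++ [false]) ++ w) = some J := by simpa using hl
        obtain ⟨I', hI', hs⟩ := H.pre _ _ _ hl'
        obtain rfl : IL = I' := by rw [hL] at hI'; exact Option.some.inj hI'
        have := haf (hs x hm) w J trivial hl' hlen hm
        simpa using this
      have key2 := key _ hf
      simp only at key2
      cases hR : s.label (v ++ [true]) with
      | none =>
        right
        obtain ⟨s', h1, h2⟩ := insert_chain x d (v ++ [true]) (base.length + v.length) s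
          (H.pre_none hR)
        rw [← hI] at h1
        refine ⟨s', [], true, I, key2.trans h1, by simp, by simpa using hv, hx, by simpa using hR,
          by simp [hL], by simpa using h2, ?_⟩
        intro w J hw hl hlen hm
        rcases w with _ | ⟨_ | _, w⟩
        · simp at hw
        · exact hleft w J hl (by simpa using hlen) hm
        · simp at hw
      | some IR =>
        rcases ih (v ++ [true]) I IR hdr hR with ⟨hf', haf'⟩ | ⟨s', p, b, Ip, h1, h2, h3, h4, h5, h6, h7, h8⟩
        · left
          refine ⟨key2.trans hf', fun _ => ?_⟩
          intro w J hw hl hlen hm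
          rcases w with _ | ⟨_ | _, w⟩
          · intro b; cases b <;> simp [hL, hR]
          · exact hleft w J hl (by simpa using hlen) hm
          · have hl' : s.label ((v ++ [true]) ++ w) = some J := by simpa using hl
            obtain ⟨I', hI', hs⟩ := H.pre _ _ _ hl'
            obtain rfl : IR = I' := by rw [hR] at hI'; exact Option.some.inj hI'
            have := haf' (hs x hm) w J trivial hl' (by simpa using hlen) hm
            simpa using this
        · right
          refine ⟨s', true :: p, b, Ip, key2.trans h1, by simp; omega, by simpa using h3, h4,
            by simpa using h5, by simpa using h6, ?_, ?_⟩
          · convert h7 using 1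
            · simp
            · simp; omega
            · simp; omega
          · intro w J hw hl hlen hm
            rcases w with _ | ⟨_ | _, w⟩
            · simp at hw
            · exact hleft w J hl (by simpa using hlen) hm
            · have := h8 w J (by simpa using hw) (by simpa using hl) (by simpa using hlen) hm
              simpa using this

/-- Successful insertion outcome. -/
structure InsOK (h : ℕ) (base : List Bool) (x : ℝ) (s s' : ETState) (p : List Bool) (b : Bool) : Prop where
  plen : p.length < h
  pmark : s.label p = some (dy (ds x (base.length + p.length)))
  cun : s.label (p ++ [b]) = none
  cl : b = true → s.label (p ++ [false]) ≠ none
  chain : Chain (p ++ [b]) (h - 1 - p.length) (base.length + p.length + 1) x s s'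
  full : ∀ w J, Lf w (p ++ [b]) → s.label w = some J → w.length < h → MemI x J → Full s w

lemma insertTop_spec {h base s} (H : TG h base s) (x : ℝ) (hx : MemI x (dy base)) :
    (etInsertTop h x s = (false, s) ∧ ∀ w J, s.label w = some J → w.length < h → MemI x J → Full s w) ∨
    (∃ s' p b, etInsertTop h x s = (true, s') ∧ InsOK h base x s s' p b) := by
  rcases insert_marked H x h [] ((s.label []).getD (0, 1)) _ (by simp) H.root with
    ⟨h1, h2⟩ | ⟨s', p, b, Ip, h1, h2, h3, h4, h5, h6, h7, h8⟩
  · left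
    exact ⟨h1, fun w J a b c => h2 hx w J trivial a b c⟩
  · right
    refine ⟨s', p, b, h1, h2, ?_, by simpa using h5, by simpa using h6, by simpa using h7, ?_⟩
    · rw [← H.lab_ds (by simpa using h3) h4]; simpa using h3
    · intro w J hw a b c; exact h8 w J hw a b c

lemma InsOK.mono {h base x s s' p b} (H : TG h base s) (S : InsOK h base x s s' p b) {u I}
    (hu : s.label u = some I) : s'.label u = some I := by
  rw [S.chain.old u, hu]
  rintro ⟨i, _, rfl⟩
  rw [H.pre_none S.cun] at hu
  simp at hu

lemma InsOK.cases {h base x s s' p b} (S : InsOK h base x s s' p b) {u I}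
    (hu : s'.label u = some I) : s.label u = some I ∨
      ∃ i ≤ h - 1 - p.length, u = p ++ [b] ++ List.replicate i false ∧
        I = dy (ds x (base.length + p.length + 1 + i)) := by
  by_cases hc : ∃ i ≤ h - 1 - p.length, u = p ++ [b] ++ List.replicate i false
  · right
    obtain ⟨i, hi, rfl⟩ := hc
    refine ⟨i, hi, rfl, ?_⟩
    rw [S.chain.new i hi] at hu
    exact (Option.some.inj hu).symm
  · left
    rw [← S.chain.old u hc]; exact hu

lemma InsOK.good {h base x s s' p b} (H : TG h base s) (hx : MemI x (dy base)) (hx0 : MemI x (0,1))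
    (S : InsOK h base x s s' p b) : TG h base s' := by
  have hb : base = ds x base.length := ds_uniq hx
  have hpl := S.plen
  refine ⟨S.mono H H.root, ?_, ?_, ?_⟩
  · intro u I hu
    rcases S.cases hu with hu | ⟨i, hi, rfl, rfl⟩
    · exact H.lab u I hu
    · refine ⟨by simp; omega, (ds x (base.length + p.length + 1 + i)).drop base.length, ?_, ?_⟩
      · simp [ds_length]; omega
      · congr 1
        conv_lhs => rw [← List.take_append_drop base.length (ds x _)]
        rw [ds_take (by omega), ← hb]
  · intro u b' J hu
    rcases S.cases hu with hu | ⟨i, hi, hu', rfl⟩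
    · obtain ⟨I, hI, hs⟩ := H.par _ _ _ hu
      exact ⟨I, S.mono H hI, hs⟩
    · cases i with
      | zero =>
        obtain ⟨rfl, _⟩ : u = p ∧ b' = b := by simpa using hu'
        exact ⟨_, S.mono H S.pmark, ds_sub x (by omega)⟩
      | succ i =>
        rw [List.replicate_succ', ← List.append_assoc] at hu'
        obtain ⟨rfl, _⟩ := List.append_inj' hu' rfl
        exact ⟨_, S.chain.new i (by omega), ds_sub x (by omega)⟩
  · intro u hu
    obtain ⟨J, hu⟩ := Option.ne_none_iff_exists'.1 hu
    rcases S.cases hu with hu | ⟨i, hi, hu', rfl⟩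
    · obtain ⟨I, hI⟩ := Option.ne_none_iff_exists'.1 (H.left u (by simp [hu]))
      simp [S.mono H hI]
    · cases i with
      | zero =>
        obtain ⟨rfl, h2⟩ : u = p ∧ true = b := by simpa using hu'
        obtain ⟨I, hI⟩ := Option.ne_none_iff_exists'.1 (S.cl h2.symm)
        simp [S.mono H hI]
      | succ i =>
        rw [List.replicate_succ', ← List.append_assoc] at hu'
        obtain ⟨_, h2⟩ := List.append_inj' hu' rfl
        simp at h2

/-! ### The ensemble -/
abbrev Tid := List Bool ⊕ ℕ
def tval (H α : ℕ) : Tid → Prop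
  | Sum.inl p => p.length < H
  | Sum.inr i => i < α
def tbase : Tid → List Bool
  | Sum.inl p => p
  | Sum.inr _ => []
def tht (H : ℕ) (t : Tid) : ℕ := H - (tbase t).length
def tkey (H : ℕ) : Tid → ℕ
  | Sum.inl p => H - 1 - p.length
  | Sum.inr i => H + i
def tget (s : EnsState) : Tid → ETState
  | Sum.inl p => s.A p
  | Sum.inr i => s.B i

lemma tryNodes_spec (x : ℝ) (k : List Bool × ℕ → ℕ) (l : List (List Bool × ℕ)) : ∀ (f : CTState),
    l.Pairwise (fun a b => k a < k b) →
    (∀ e ∈ l, etInsertTop e.2 x (f e.1) = (false, f e.1) ∨ ∃ s', etInsertTop e.2 x (f e.1) = (true, s')) →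
    (tryNodes x l f = (false, f) ∧ ∀ e ∈ l, etInsertTop e.2 x (f e.1) = (false, f e.1)) ∨
    ∃ e ∈ l, ∃ s', tryNodes x l f = (true, fun q => if q = e.1 then s' else f q) ∧
      etInsertTop e.2 x (f e.1) = (true, s') ∧
      ∀ e' ∈ l, k e' < k e → etInsertTop e'.2 x (f e'.1) = (false, f e'.1) := by
  induction l with
  | nil => intro f _ _; left; simp [tryNodes]
  | cons a l ih =>
    intro f hp hf
    rw [List.pairwise_cons] at hp
    rcases hf a (by simp) with h0 | ⟨s', h0⟩
    · have heq : tryNodes x (a :: l) f = tryNodes x l f := by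
        obtain ⟨p, ht⟩ := a
        simp only [tryNodes]
        simp only at h0
        rw [h0]
        simp only
        congr 1
        funext q
        split_ifs with hq
        · rw [hq]
        · rfl
      rw [heq]
      rcases ih f hp.2 (fun e he => hf e (by simp [he])) with ⟨h1, h2⟩ | ⟨e, he, s', h1, h2, h3⟩
      · left
        refine ⟨h1, ?_⟩
        intro e he
        rcases List.mem_cons.1 he with rfl | he
        · exact h0
        · exact h2 e he
      · right
        refine ⟨e, by simp [he], s', h1, h2, ?_⟩
        intro e' he' hk
        rcases List.mem_cons.1 he' with rfl | he'
        · exact h0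
        · exact h3 e' he' hk
    · right
      refine ⟨a, by simp, s', ?_, h0, ?_⟩
      · obtain ⟨p, ht⟩ := a
        simp only [tryNodes]
        simp only at h0
        rw [h0]
        rfl
      · intro e' he' hk
        rcases List.mem_cons.1 he' with rfl | he'
        · omega
        · have := hp.1 e' he'; omega

lemma tryBs_spec (H : ℕ) (x : ℝ) (l : List ℕ) : ∀ (f : ℕ → ETState),
    l.Pairwise (fun a b => a < b) →
    (∀ e ∈ l, etInsertTop H x (f e) = (false, f e) ∨ ∃ s', etInsertTop H x (f e) = (true, s')) →
    (tryBs H x l f = (false, f) ∧ ∀ e ∈ l, etInsertTop H x (f e) = (false, f e)) ∨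
    ∃ e ∈ l, ∃ s', tryBs H x l f = (true, fun q => if q = e then s' else f q) ∧
      etInsertTop H x (f e) = (true, s') ∧
      ∀ e' ∈ l, e' < e → etInsertTop H x (f e') = (false, f e') := by
  induction l with
  | nil => intro f _ _; left; simp [tryBs]
  | cons a l ih =>
    intro f hp hf
    rw [List.pairwise_cons] at hp
    rcases hf a (by simp) with h0 | ⟨s', h0⟩
    · have heq : tryBs H x (a :: l) f = tryBs H x l f := by
        simp only [tryBs]
        rw [h0]
        simp only
        congr 1
        funext q
        split_ifs with hq
        · rw [hq]
        · rfl
      rw [heq]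
      rcases ih f hp.2 (fun e he => hf e (by simp [he])) with ⟨h1, h2⟩ | ⟨e, he, s', h1, h2, h3⟩
      · left
        refine ⟨h1, ?_⟩
        intro e he
        rcases List.mem_cons.1 he with rfl | he
        · exact h0
        · exact h2 e he
      · right
        refine ⟨e, by simp [he], s', h1, h2, ?_⟩
        intro e' he' hk
        rcases List.mem_cons.1 he' with rfl | he'
        · exact h0
        · exact h3 e' he' hk
    · right
      refine ⟨a, by simp, s', ?_, h0, ?_⟩
      · simp only [tryBs]
        rw [h0]
      · intro e' he' hk
        rcases List.mem_cons.1 he' with rfl | he'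
        · omega
        · have := hp.1 e' he'; omega

lemma mem_nodeSeq {H : ℕ} {x : ℝ} {e : List Bool × ℕ} : e ∈ ctNodeSeq H (0,1) x ↔
    ∃ i < H, e = (ds x (H - 1 - i), i + 1) := by
  unfold ctNodeSeq
  simp only [List.mem_map, List.mem_range]
  constructor
  · rintro ⟨i, hi, rfl⟩
    refine ⟨i, hi, ?_⟩
    rw [descend_take _ _ _ _ (by omega)]; rfl
  · rintro ⟨i, hi, rfl⟩
    refine ⟨i, hi, ?_⟩
    rw [descend_take _ _ _ _ (by omega)]; rfl

def GoodAll (H α : ℕ) (s : EnsState) : Prop :=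
  ∀ t, tval H α t → TG (tht H t) (tbase t) (tget s t)

lemma dy_nil : dy [] = (0, 1) := rfl

lemma ens_spec {H α : ℕ} {s : EnsState} {x : ℝ} (hg : GoodAll H α s) (hx : MemI x (0,1)) :
    (ensInsert H α (0,1) x s = (false, s) ∧ ∀ t, tval H α t → MemI x (dy (tbase t)) →
      etInsertTop (tht H t) x (tget s t) = (false, tget s t)) ∨
    ∃ s' t e', ensInsert H α (0,1) x s = (true, s') ∧ tval H α t ∧ MemI x (dy (tbase t)) ∧
      etInsertTop (tht H t) x (tget s t) = (true, e') ∧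
      (∀ t', tget s' t' = if t' = t then e' else tget s t') ∧
      ∀ t', tval H α t' → MemI x (dy (tbase t')) → tkey H t' < tkey H t →
        etInsertTop (tht H t') x (tget s t') = (false, tget s t') := by
  have outc : ∀ t, tval H α t → MemI x (dy (tbase t)) →
      etInsertTop (tht H t) x (tget s t) = (false, tget s t) ∨
      ∃ s', etInsertTop (tht H t) x (tget s t) = (true, s') := by
    intro t ht hm
    rcases insertTop_spec (hg t ht) x hm with h | ⟨s', p, b, h, _⟩
    · exact Or.inl h.1
    · exact Or.inr ⟨s', h⟩
  have hA := tryNodes_spec x (fun e => e.2) (ctNodeSeq H (0,1) x) s.A (by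
      unfold ctNodeSeq
      rw [List.pairwise_map]
      refine List.pairwise_lt_range.imp ?_
      intro a b h
      simpa using h) (by
      intro e he
      obtain ⟨i, hi, rfl⟩ := mem_nodeSeq.1 he
      have := outc (Sum.inl (ds x (H - 1 - i))) (by simp [tval, ds_length]; omega) (ds_mem hx _)
      simp only [tht, tbase, tget, ds_length] at this
      rwa [show H - (H - 1 - i) = i + 1 by omega] at this)
  have conv : ∀ p : List Bool, p.length < H → MemI x (dy p) →
      (p, H - p.length) ∈ ctNodeSeq H (0,1) x := by
    intro p hp hm
    rw [mem_nodeSeq]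
    refine ⟨H - 1 - p.length, by omega, ?_⟩
    rw [show H - 1 - (H - 1 - p.length) = p.length by omega, ← ds_uniq hm,
      show H - 1 - p.length + 1 = H - p.length by omega]
  have hens : ensInsert H α (0,1) x s = match tryNodes x (ctNodeSeq H (0,1) x) s.A with
      | (true, A') => (true, ⟨A', s.B⟩)
      | (false, A') =>
        let r := tryBs H x (List.range α) s.B
        (r.1, ⟨A', r.2⟩) := rfl
  rcases hA with ⟨h1, h2⟩ | ⟨e, he, e', h1, h2, h3⟩
  · have hAf : ∀ p : List Bool, p.length < H → MemI x (dy p) →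
        etInsertTop (tht H (Sum.inl p)) x (tget s (Sum.inl p)) = (false, tget s (Sum.inl p)) :=
      fun p hp hm => h2 _ (conv p hp hm)
    have hB := tryBs_spec H x (List.range α) s.B List.pairwise_lt_range (by
      intro i hi
      exact outc (Sum.inr i) (by simpa [tval] using hi) (by simpa [tbase, dy_nil] using hx))
    rw [h1] at hens
    simp only at hens
    rcases hB with ⟨h4, h5⟩ | ⟨i, hi, e', h4, h5, h6⟩
    · left
      rw [h4] at hens
      refine ⟨hens, ?_⟩
      rintro (p | i) hv hm
      · exact hAf p hv hm
      · exact h5 i (by simpa [tval] using hv)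
    · right
      rw [h4] at hens
      refine ⟨_, Sum.inr i, e', hens, by simpa [tval] using hi, by simpa [tbase, dy_nil] using hx, h5, ?_, ?_⟩
      · rintro (p | i')
        · simp [tget]
        · by_cases hii : i' = i
          · simp [tget, hii]
          · simp [tget, hii]
      · rintro (p | i') hv hm hk
        · exact hAf p hv hm
        · exact h6 i' (by simpa [tval] using hv) (by simpa [tkey] using hk)
  · right
    rw [h1] at hens
    simp only at hens
    obtain ⟨i, hi, rfl⟩ := mem_nodeSeq.1 he
    refine ⟨_, Sum.inl (ds x (H - 1 - i)), e', hens, by simp [tval, ds_length]; omega, ds_mem hx _, ?_, ?_, ?_⟩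
    · simp only [tht, tbase, tget, ds_length]
      rwa [show H - (H - 1 - i) = i + 1 by omega]
    · rintro (p | i')
      · by_cases hp : p = ds x (H - 1 - i)
        · simp [tget, hp]
        · simp [tget, hp]
      · simp [tget]
    · rintro (p | i') hv hm hk
      · refine h3 _ (conv p hv hm) ?_
        simp [tkey, ds_length] at hk
        simp only [tval] at hv
        simp only
        omega
      · simp [tkey, ds_length] at hk
        omega

def Bef (H : ℕ) (t : Tid) (u : List Bool) (t' : Tid) (u' : List Bool) : Prop :=
  tkey H t < tkey H t' ∨ (t = t' ∧ Lf u u')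

def KInv (H α : ℕ) (s : EnsState) : Prop :=
  ∀ t t' u u' I J, tval H α t → tval H α t' → u' ≠ [] → (tget s t).label u = some I →
    (tget s t').label u' = some J → u.length < tht H t → SubI J I → Bef H t u t' u' →
    Full (tget s t) u

/-- marked non-root nodes of dyadic depth `d` -/
def Dyn (H α : ℕ) (s : EnsState) (d : ℕ) : Set (Tid × List Bool) :=
  {z | tval H α z.1 ∧ z.2 ≠ [] ∧ (tbase z.1).length + z.2.length = d ∧
    (tget s z.1).label z.2 ≠ none}

lemma tval_base {H α : ℕ} (hH : 0 < H) {t : Tid} (h : tval H α t) : (tbase t).length < H := by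
  cases t <;> simp_all [tval, tbase]

lemma Full.mono {s s' : ETState} {u : List Bool} (h : ∀ v I, s.label v = some I → s'.label v = some I)
    (hf : Full s u) : Full s' u := by
  intro b
  obtain ⟨I, hI⟩ := Option.ne_none_iff_exists'.1 (hf b)
  simp [h _ _ hI]

lemma ens_step {H α : ℕ} (hH : 0 < H) {s : EnsState} {x : ℝ} (hg : GoodAll H α s) (hk : KInv H α s)
    (hx : MemI x (0,1)) :
    (ensInsert H α (0,1) x s = (false, s) ∧ ∀ t w J, tval H α t → (tget s t).label w = some J →
      w.length < tht H t → MemI x J → Full (tget s t) w) ∨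
    ∃ s', ensInsert H α (0,1) x s = (true, s') ∧ GoodAll H α s' ∧ KInv H α s' ∧
      ∃ z, Dyn H α s' H ⊆ insert z (Dyn H α s H) := by
  have fullof : ∀ t, tval H α t → MemI x (dy (tbase t)) →
      etInsertTop (tht H t) x (tget s t) = (false, tget s t) → ∀ w J, (tget s t).label w = some J →
      w.length < tht H t → MemI x J → Full (tget s t) w := by
    intro t ht hm hf
    rcases insertTop_spec (hg t ht) x hm with h | ⟨s', p, b, h, _⟩
    · exact h.2
    · rw [h] at hf; simp at hf
  have rootmem : ∀ t w J, tval H α t → (tget s t).label w = some J → MemI x J → MemI x (dy (tbase t)) := by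
    intro t w J ht hw hm
    obtain ⟨_, q, _, rfl⟩ := (hg t ht).lab w J hw
    exact dy_sub_append _ _ x hm
  rcases ens_spec hg hx with ⟨h1, h2⟩ | ⟨s', t0, e', h1, hv0, hm0, h4, h5, h6⟩
  · left
    refine ⟨h1, ?_⟩
    intro t w J ht hw hl hm
    have hr := rootmem t w J ht hw hm
    exact fullof t ht hr (h2 t ht hr) w J hw hl hm
  right
  have hg0 := hg t0 hv0
  obtain ⟨p, b, S⟩ : ∃ p b, InsOK (tht H t0) (tbase t0) x (tget s t0) e' p b := by
    rcases insertTop_spec hg0 x hm0 with h | ⟨s'', p, b, h, S⟩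
    · rw [h4] at h; simp at h
    · rw [h4] at h
      simp at h
      exact ⟨p, b, h ▸ S⟩
  have hnew : tget s' t0 = e' := by rw [h5, if_pos rfl]
  have hother : ∀ t, t ≠ t0 → tget s' t = tget s t := fun t ht => by rw [h5, if_neg ht]
  have hmono : ∀ t u I, (tget s t).label u = some I → (tget s' t).label u = some I := by
    intro t u I h
    by_cases ht : t = t0
    · subst ht; rw [hnew]; exact S.mono hg0 h
    · rwa [hother t ht]
  have hcases : ∀ t u I, (tget s' t).label u = some I → (tget s t).label u = some I ∨
      (t = t0 ∧ ∃ i ≤ tht H t0 - 1 - p.length, u = p ++ [b] ++ List.replicate i false ∧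
        I = dy (ds x ((tbase t0).length + p.length + 1 + i))) := by
    intro t u I h
    by_cases ht : t = t0
    · subst ht; rw [hnew] at h
      rcases S.cases h with h | h
      · exact Or.inl h
      · exact Or.inr ⟨rfl, h⟩
    · rw [hother t ht] at h; exact Or.inl h
  refine ⟨s', h1, ?_, ?_, ?_⟩
  · intro t ht
    by_cases h : t = t0
    · subst h; rw [hnew]; exact S.good hg0 hm0 hx
    · rw [hother t h]; exact hg t ht
  · intro t t' u u' I J ht ht' hu' hI hJ hlen hsub hbef
    rcases hcases t u I hI with hI0 | ⟨rfl, i, hi, rfl, rfl⟩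
    · apply Full.mono (hmono t)
      rcases hcases t' u' J hJ with hJ0 | ⟨rfl, i, hi, rfl, rfl⟩
      · exact hk t t' u u' I J ht ht' hu' hI0 hJ0 hlen hsub hbef
      · have hmI : MemI x I := hsub x (ds_mem hx _)
        rcases hbef with hb | ⟨rfl, hb⟩
        · have hr := rootmem t u I ht hI0 hmI
          exact fullof t ht hr (h6 t ht hr hb) u I hI0 hlen hmI
        · rcases Lf_right _ _ _ hb with hb | ⟨z, _, hz⟩
          · exact S.full u I hb hI0 hlen hmI
          · exact absurd hz (Lf_replicate _ _)
    · exfalso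
      have hpn : ¬ Full (tget s t) p := fun h => h b S.cun
      have hlp : p.length < tht H t := S.plen
      rcases hcases t' u' J hJ with hJ0 | ⟨rfl, i', hi', rfl, rfl⟩
      · have hsub' : SubI J (dy (ds x ((tbase t).length + p.length))) := fun y hy =>
          ds_sub x (by omega) y (hsub y hy)
        rcases hbef with hb | ⟨rfl, hb⟩
        · exact hpn (hk t t' p u' _ J ht ht' hu' S.pmark hJ0 hlp hsub' (Or.inl hb))
        · rw [List.append_assoc, List.singleton_append] at hb
          rcases Lf_left _ _ _ _ hb with hb | ⟨hbf, z, hz⟩ | ⟨z, hz⟩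
          · exact hpn (hk t t p u' _ J ht ht' hu' S.pmark hJ0 hlp hsub' (Or.inr ⟨rfl, hb⟩))
          · have h7 : (tget s t).label ((p ++ [true]) ++ z) = some J := by
              rw [← hJ0, hz]; simp
            obtain ⟨I', hI', _⟩ := hg0.pre _ _ _ h7
            have := hg0.left p (by simp [hI'])
            apply this
            rw [← hbf]; exact S.cun
          · have h7 : (tget s t).label ((p ++ [b]) ++ z) = some J := by
              rw [← hJ0, hz]; simp
            rw [hg0.pre_none S.cun] at h7
            simp at h7
      · rcases hbef with hb | ⟨_, hb⟩
        · exact absurd hb (lt_irrefl _)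
        · rw [Lf_append] at hb
          exact Lf_replicate _ _ hb
  · refine ⟨(t0, p ++ [b] ++ List.replicate (tht H t0 - 1 - p.length) false), ?_⟩
    rintro ⟨t, u⟩ ⟨hv, hu, hl, hm⟩
    simp only at hv hu hl hm
    obtain ⟨I, hI⟩ := Option.ne_none_iff_exists'.1 hm
    rcases hcases t u I hI with h | ⟨rfl, i, hi, rfl, rfl⟩
    · right
      exact ⟨hv, hu, hl, by simp [h]⟩
    · left
      have : i = tht H t - 1 - p.length := by
        have h1 := S.plen
        have h2 := tval_base hH hv
        simp at hl
        unfold tht at *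
        omega
      rw [this]

/-! ### Counting -/
def Sites (H α : ℕ) (s : EnsState) (d : ℕ) : Set (Tid × List Bool) :=
  {z | tval H α z.1 ∧ (tbase z.1).length + z.2.length = d ∧ (tget s z.1).label z.2 ≠ none}

lemma tval_finite (H α : ℕ) : {t : Tid | tval H α t}.Finite := by
  have h1 : (Sum.inl '' {l : List Bool | l.length ≤ H} ∪ Sum.inr '' (Set.Iio α) : Set Tid).Finite :=
    ((List.finite_length_le Bool H).image _).union ((Set.finite_Iio α).image _)
  refine h1.subset ?_
  rintro (p | i) h
  · left; exact ⟨p, show p.length ≤ H from le_of_lt h, rfl⟩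
  · right; exact ⟨i, h, rfl⟩

lemma sites_finite (H α : ℕ) (s : EnsState) (d : ℕ) : (Sites H α s d).Finite := by
  refine ((tval_finite H α).prod (List.finite_length_le Bool d)).subset ?_
  rintro ⟨t, u⟩ ⟨h1, h2, _⟩
  simp only at h1 h2
  refine ⟨h1, ?_⟩
  simp only [Set.mem_ofPred_eq]
  omega

lemma dyn_sub (H α : ℕ) (s : EnsState) (d : ℕ) : Dyn H α s d ⊆ Sites H α s d :=
  fun _ h => ⟨h.1, h.2.2.1, h.2.2.2⟩

lemma dyn_finite (H α : ℕ) (s : EnsState) (d : ℕ) : (Dyn H α s d).Finite :=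
  (sites_finite H α s d).subset (dyn_sub H α s d)

lemma children_count {H α : ℕ} {s : EnsState} {d : ℕ} (F : Set (Tid × List Bool))
    (hF : F ⊆ Sites H α s d) (hf : ∀ z ∈ F, Full (tget s z.1) z.2) :
    2 * F.ncard ≤ (Dyn H α s (d+1)).ncard := by
  have h := Set.ncard_le_ncard_of_injOn (s := F ×ˢ (Set.univ : Set Bool)) (t := Dyn H α s (d+1))
    (fun z => (z.1.1, z.1.2 ++ [z.2])) (by
      rintro ⟨⟨t, u⟩, b⟩ ⟨hz, _⟩
      obtain ⟨h1, h2, h3⟩ := hF hz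
      refine ⟨h1, by simp, ?_, hf _ hz b⟩
      simp at h2 ⊢
      omega) (by
      rintro ⟨⟨t, u⟩, b⟩ _ ⟨⟨t', u'⟩, b'⟩ _ h
      simp at h
      simp [h]) (dyn_finite _ _ _ _)
  rw [Set.ncard_prod, Set.ncard_univ, Nat.card_eq_fintype_card, Fintype.card_bool] at h
  omega

lemma open_inj {H α : ℕ} (hH : 0 < H) {s : EnsState} (hg : GoodAll H α s) (hk : KInv H α s)
    {d : ℕ} (hd : 1 ≤ d) (hdH : d < H) {t t' : Tid} {u u' q : List Bool}
    (hz : (t, u) ∈ Sites H α s d) (hz' : (t', u') ∈ Sites H α s d)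
    (ho : ¬ Full (tget s t) u) (ho' : ¬ Full (tget s t') u')
    (hq : (tget s t).label u = some (dy q)) (hq' : (tget s t').label u' = some (dy q))
    (hlq : q.length = d) : (t, u) = (t', u') := by
  obtain ⟨hv, hl, -⟩ := hz
  obtain ⟨hv', hl', -⟩ := hz'
  simp only at hv hv' hl hl'
  have pref : ∀ (t : Tid) (u : List Bool), tval H α t → (tbase t).length + u.length = d →
      (tget s t).label u = some (dy q) → ∃ r, q = tbase t ++ r := by
    intro t u hv hl hu
    obtain ⟨_, r, hr, h⟩ := (hg t hv).lab u _ hu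
    exact ⟨r, dy_inj (by simp; omega) h⟩
  have hlen : ∀ (t : Tid) (u : List Bool), tval H α t → (tbase t).length + u.length = d →
      u.length < tht H t := by
    intro t u hv hl
    unfold tht
    have := tval_base hH hv
    omega
  have main : ∀ (t t' : Tid) (u u' : List Bool), tval H α t → tval H α t' →
      (tbase t).length + u.length = d → (tbase t').length + u'.length = d →
      (tget s t).label u = some (dy q) → (tget s t').label u' = some (dy q) →
      tkey H t < tkey H t' → Full (tget s t) u := by
    intro t t' u u' hv hv' hl hl' hq hq' hkey
    refine hk t t' u u' _ _ hv hv' ?_ hq hq' (hlen t u hv hl) (fun _ h => h) (Or.inl hkey)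
    rintro rfl
    obtain ⟨r, hr⟩ := pref t u hv hl hq
    have hrl := congrArg List.length hr
    simp at hrl hl'
    rcases t' with p' | i'
    · rcases t with p | i
      · simp [tkey, tbase, tval] at *
        omega
      · simp [tkey, tbase, tval] at *
        omega
    · simp [tbase] at hl'
      omega
  rcases lt_trichotomy (tkey H t) (tkey H t') with h | h | h
  · exact absurd (main t t' u u' hv hv' hl hl' hq hq' h) ho
  · have htt : t = t' := by
      obtain ⟨r, hr⟩ := pref t u hv hl hq
      obtain ⟨r', hr'⟩ := pref t' u' hv' hl' hq'
      rcases t with p | i <;> rcases t' with p' | i'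
      · simp [tkey, tbase, tval] at *
        rw [hr] at hr'
        exact (List.append_inj hr' (by omega)).1
      · simp [tkey, tbase, tval] at *
        omega
      · simp [tkey, tbase, tval] at *
        omega
      · simp [tkey, tbase, tval] at *
        omega
    subst htt
    by_contra hne
    have hne' : u ≠ u' := fun h => hne (by rw [h])
    have hL := hlen t u hv hl
    have hL' := hlen t u' hv' hl'
    rcases Lf_tri u u' (by omega) hne' with h | h
    · exact ho (hk t t u u' _ _ hv hv' (by rintro rfl; simp at h) hq hq' hL (fun _ h => h) (Or.inr ⟨rfl, h⟩))
    · exact ho' (hk t t u' u _ _ hv hv' (by rintro rfl; simp at h) hq' hq hL' (fun _ h => h) (Or.inr ⟨rfl, h⟩))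
  · exact absurd (main t' t u' u hv' hv hl' hl hq' hq h) ho'

lemma dyn_double {H α : ℕ} (hH : 0 < H) {s : EnsState} (hg : GoodAll H α s) (hk : KInv H α s)
    {d : ℕ} (hd : 1 ≤ d) (hdH : d < H) :
    2 * (Dyn H α s d).ncard ≤ (Dyn H α s (d+1)).ncard := by
  set S := Sites H α s d with hS
  have hSf : S.Finite := sites_finite H α s d
  set F : Set (Tid × List Bool) := {z ∈ S | Full (tget s z.1) z.2} with hF
  set R : Set (Tid × List Bool) := S \ Dyn H α s d with hR
  have hFc := children_count (H := H) (α := α) (s := s) (d := d) F (fun z h => h.1) (fun z h => h.2)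
  have hlab : ∀ z : Tid × List Bool, ∃ q, z ∈ S → q.length = d ∧ (tget s z.1).label z.2 = some (dy q) := by
    rintro ⟨t, u⟩
    by_cases hz : (t, u) ∈ S
    · obtain ⟨h1, h2, h3⟩ := hz
      obtain ⟨I, hI⟩ := Option.ne_none_iff_exists'.1 h3
      obtain ⟨_, r, hr, rfl⟩ := (hg t h1).lab u I hI
      refine ⟨tbase t ++ r, fun _ => ⟨?_, hI⟩⟩
      simp at h2 ⊢
      omega
    · exact ⟨[], fun h => absurd h hz⟩
  choose Q hQ using hlab
  have hopen : (S \ F).ncard ≤ R.ncard := by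
    refine Set.ncard_le_ncard_of_injOn (fun z => (Sum.inl (Q z), [])) ?_ ?_ (hSf.subset Set.sdiff_subset)
    · intro z hz
      have hq := hQ z hz.1
      have hv : tval H α (Sum.inl (Q z)) := by simp [tval]; omega
      refine ⟨⟨hv, by simp [tbase, hq.1], ?_⟩, ?_⟩
      · simp [(hg _ hv).root]
      · rintro ⟨_, h, _⟩
        exact h rfl
    · rintro ⟨t, u⟩ hz ⟨t', u'⟩ hz' h
      simp at h
      have hq := hQ _ hz.1
      have hq' := hQ _ hz'.1
      rw [← h] at hq'
      exact open_inj hH hg hk hd hdH hz.1 hz'.1 (fun hf => hz.2 ⟨hz.1, hf⟩)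
        (fun hf => hz'.2 ⟨hz'.1, hf⟩) hq.2 hq'.2 hq.1
  have e1 := Set.ncard_sdiff_add_ncard_of_subset (show F ⊆ S from fun z h => h.1) hSf
  have e2 := Set.ncard_sdiff_add_ncard_of_subset (dyn_sub H α s d) hSf
  rw [← hS, ← hR] at e2
  omega

lemma dyn_one {H α : ℕ} (hH : 0 < H) {s : EnsState} (hg : GoodAll H α s)
    (hf : ∀ t, tval H α t → tbase t = [] → Full (tget s t) []) :
    2 * (α + 1) ≤ (Dyn H α s 1).ncard := by
  set F : Set (Tid × List Bool) :=
    (fun i : ℕ => if i = 0 then (Sum.inl [], []) else (Sum.inr (i-1), [])) '' (Set.Iio (α+1)) with hF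
  have hc : F.ncard = α + 1 := by
    rw [hF, Set.ncard_image_of_injOn]
    · simp [Set.ncard_eq_toFinset_card']
    · intro a _ b _ h
      simp only at h
      split_ifs at h <;> simp at h <;> omega
  have hmem : ∀ z ∈ F, tval H α z.1 ∧ tbase z.1 = [] ∧ z.2 = [] := by
    rintro z ⟨i, hi, rfl⟩
    simp at hi
    by_cases h0 : i = 0
    · simp [h0, tval, tbase, hH]
    · simp [h0, tval, tbase]; omega
  rw [← hc]
  refine children_count (d := 0) F ?_ ?_
  · rintro ⟨t, u⟩ hz
    obtain ⟨h1, h2, h3⟩ := hmem _ hz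
    simp only at h1 h2 h3
    subst h3
    exact ⟨h1, by simp [h2], by simp [(hg t h1).root]⟩
  · rintro ⟨t, u⟩ hz
    obtain ⟨h1, h2, h3⟩ := hmem _ hz
    simp only at h1 h2 h3
    subst h3
    exact hf t h1 h2

lemma dyn_big {H α : ℕ} (hH : 0 < H) {s : EnsState} (hg : GoodAll H α s) (hk : KInv H α s)
    (hf : ∀ t, tval H α t → tbase t = [] → Full (tget s t) []) :
    2 ^ H * (α + 1) ≤ (Dyn H α s H).ncard := by
  have : ∀ m, m + 1 ≤ H → 2 ^ (m+1) * (α + 1) ≤ (Dyn H α s (m+1)).ncard := by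
    intro m
    induction m with
    | zero => intro _; simpa using dyn_one hH hg hf
    | succ m ih =>
      intro hm
      have h1 := ih (by omega)
      have h2 := dyn_double hH hg hk (d := m+1) (by omega) (by omega)
      rw [pow_succ]
      nlinarith
  have h := this (H - 1) (by omega)
  rwa [show H - 1 + 1 = H by omega] at h

lemma run_aux {H α : ℕ} (hH : 0 < H) (xs : List ℝ) : ∀ (s : EnsState) (n : ℕ), GoodAll H α s → KInv H α s →
    (Dyn H α s H).ncard ≤ n → n + xs.length ≤ 2 ^ H * α → (∀ x ∈ xs, MemI x (0,1)) →
    (xs.foldl (fun acc x =>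
      let r := ensInsert H α (0,1) x acc.2
      (acc.1 && r.1, r.2)) (true, s)).1 = true := by
  induction xs with
  | nil => intros; rfl
  | cons x xs ih =>
    intro s n hg hk hn hlen hxs
    have hx := hxs x (by simp)
    rw [List.foldl_cons]
    simp only [List.length_cons] at hlen
    rcases ens_step hH hg hk hx with ⟨_, hf⟩ | ⟨s', h1, hg', hk', z, hz⟩
    · exfalso
      have := dyn_big hH hg hk (by
        intro t ht hb
        refine hf t [] _ ht (hg t ht).root ?_ ?_
        · simp [tht, hb, hH]
        · rw [hb]; exact hx)
      nlinarith
    · have hc : (Dyn H α s' H).ncard ≤ n + 1 :=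
        (Set.ncard_le_ncard hz ((dyn_finite _ _ _ _).insert z)).trans
          ((Set.ncard_insert_le _ _).trans (by omega))
      have := ih s' (n+1) hg' hk' hc (by omega) (fun y hy => hxs y (by simp [hy]))
      simp only [h1, Bool.and_self]
      exact this

lemma init_label {I : ℝ × ℝ} {u : List Bool} {J : ℝ × ℝ} (h : (ETState.init I).label u = some J) :
    u = [] ∧ J = I := by
  simp only [ETState.init] at h
  split_ifs at h with hu
  exact ⟨hu, (Option.some.inj h).symm⟩

lemma tget_init (t : Tid) : tget (ensInit (0,1)) t = ETState.init (dy (tbase t)) := by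
  cases t <;> rfl

lemma init_good (H α : ℕ) : GoodAll H α (ensInit (0,1)) := by
  intro t ht
  rw [tget_init]
  refine ⟨by simp [ETState.init], ?_, ?_, ?_⟩
  · intro u I hu
    obtain ⟨rfl, rfl⟩ := init_label hu
    exact ⟨by simp, [], by simp⟩
  · intro u b J hu
    have := (init_label hu).1
    simp at this
  · intro u hu
    obtain ⟨J, hJ⟩ := Option.ne_none_iff_exists'.1 hu
    have := (init_label hJ).1
    simp at this

lemma init_K (H α : ℕ) : KInv H α (ensInit (0,1)) := by
  intro t t' u u' I J ht ht' hu' hI hJ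
  rw [tget_init] at hJ
  exact absurd (init_label hJ).1 hu'

lemma init_dyn (H α : ℕ) : (Dyn H α (ensInit (0,1)) H).ncard ≤ 0 := by
  have : Dyn H α (ensInit (0,1)) H = ∅ := by
    ext ⟨t, u⟩
    simp only [Set.mem_empty_iff_false, iff_false]
    rintro ⟨_, h, _, h'⟩
    obtain ⟨J, hJ⟩ := Option.ne_none_iff_exists'.1 h'
    rw [tget_init] at hJ
    exact h (init_label hJ).1
  simp [this]

/-!
STATEMENT 19: let `n = 2 ^ k` and `α = 2 ^ j` be powers of two with `1 ≤ α ≤ log₂ n`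
(i.e. `2 ^ j ≤ k`), and consider the tree ensemble of order `α` whose composite tree and
elementary trees all have height `H = log₂ (n / α) = k - j` and whose common root label is
`[0, 1)`.  If at most `n` elements of `[0, 1)` are inserted one by one via the ensemble
insertion algorithm, then no insertion ever fails.
-/
theorem statement19 (k j : ℕ) (hjk : 2 ^ j ≤ k)
    (xs : List ℝ) (hlen : xs.length ≤ 2 ^ k)
    (hxs : ∀ x ∈ xs, x ∈ Set.Ico (0 : ℝ) 1) :
    (ensRun (k - j) (2 ^ j) (0, 1) xs).1 = true := by
  have hj : j < 2 ^ j := Nat.lt_two_pow_self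
  refine run_aux (by omega) xs (ensInit (0,1)) 0 (init_good _ _) (init_K _ _) (init_dyn _ _) ?_ ?_
  · rw [← pow_add, Nat.sub_add_cancel (by omega)]; omega
  · intro x hx; exact hxs x hx
end
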